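/- For every integer i ≥ 1 and every number of variables n ≥ 1, the one-row Schur P-function P_i = (1/2)·∑_{j=0}^{i} e_j · h_{i−j} lies in the ℚ-subalgebra Algebra.adjoin ℚ {p_k : k odd, 1 ≤ k ≤ i} of MvPolynomial (Fin n) ℚ generated by the odd-indexed power sums of degree at most i. (That is, P_i can be written as a polynomial in odd power sum symmetric functions only.) -/

import Mathlib

open MvPolynomial Finset

lemma aux_geom {A : Type*} [CommRing A] (x : A) :
    (PowerSeries.mk (fun k => x ^ k)) * (1 - PowerSeries.C x * PowerSeries.X) = 1 := by
  ext k
  rw [mul_sub, mul_one, mul_comm (PowerSeries.C x), ← mul_assoc]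
  cases k with
  | zero => simp
  | succ k => simp [PowerSeries.coeff_succ_mul_X, pow_succ, PowerSeries.coeff_one]

lemma aux_factor {A : Type*} [CommRing A] (x : A) :
    PowerSeries.derivative A ((1 + PowerSeries.C x * PowerSeries.X) *
      PowerSeries.mk (fun k => x ^ k)) =
    ((1 + PowerSeries.C x * PowerSeries.X) * PowerSeries.mk (fun k => x ^ k)) *
      PowerSeries.mk (fun m => x ^ (m + 1) * (1 + (-1) ^ m)) := by
  have hr : PowerSeries.mk (fun m => x ^ (m + 1) * (1 + (-1) ^ m)) =
      PowerSeries.C x * PowerSeries.mk (fun k => x ^ k) +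
      PowerSeries.C x * PowerSeries.mk (fun k => (-x) ^ k) := by
    ext m
    simp only [PowerSeries.coeff_mk, map_add, PowerSeries.coeff_C_mul]
    rw [neg_pow x]; ring
  have h1 := aux_geom x
  have h2 := aux_geom (-x)
  have h3 := congrArg (PowerSeries.derivative A) h1
  rw [hr]
  set G := PowerSeries.mk (fun k => x ^ k)
  set K := PowerSeries.mk (fun k => (-x) ^ k)
  simp only [Derivation.leibniz, map_sub, map_add, smul_eq_mul, PowerSeries.derivative_C,
    PowerSeries.derivative_X, Derivation.map_one_eq_zero, map_neg] at h2 h3 ⊢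
  set D := PowerSeries.derivative A G
  set c := PowerSeries.C x
  set t := (PowerSeries.X : PowerSeries A)
  have h4 : D = c * G ^ 2 := by linear_combination G * h3 - D * h1
  rw [h4]
  linear_combination (- c * G) * h2

lemma aux_prod {A σ : Type*} [CommRing A] (f r : σ → PowerSeries A)
    (h : ∀ i, PowerSeries.derivative A (f i) = f i * r i) (s : Finset σ) :
    PowerSeries.derivative A (∏ i ∈ s, f i) = (∏ i ∈ s, f i) * ∑ i ∈ s, r i := by
  classical
  induction s using Finset.induction_on with
  | empty => simp
  | insert a s ha ih =>
    rw [prod_insert ha, sum_insert ha, Derivation.leibniz, ih, h, smul_eq_mul, smul_eq_mul]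
    ring

lemma aux_E (n j : ℕ) : PowerSeries.coeff j (∏ i : Fin n,
    (1 + PowerSeries.C (X i : MvPolynomial (Fin n) ℚ) * PowerSeries.X)) =
    esymm (Fin n) ℚ j := by
  rw [prod_one_add, map_sum, esymm]
  have : ∀ s : Finset (Fin n), PowerSeries.coeff j (∏ i ∈ s,
      (PowerSeries.C (X i : MvPolynomial (Fin n) ℚ) * PowerSeries.X)) =
      if s.card = j then ∏ i ∈ s, X i else 0 := by
    intro s
    rw [prod_mul_distrib, prod_const, ← map_prod, PowerSeries.coeff_C_mul,
      PowerSeries.coeff_X_pow]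
    simp [eq_comm]
  simp_rw [this]
  rw [← sum_filter]
  apply sum_congr _ (fun _ _ => rfl)
  ext s
  simp [mem_powersetCard]

lemma aux_H (n j : ℕ) : PowerSeries.coeff j (∏ i : Fin n,
    PowerSeries.mk (fun k => (X i : MvPolynomial (Fin n) ℚ) ^ k)) =
    hsymm (Fin n) ℚ j := by
  rw [PowerSeries.coeff_prod, hsymm]
  symm
  refine sum_bij (fun s _ => Multiset.toFinsupp (s : Multiset (Fin n))) ?_ ?_ ?_ ?_
  · intro s _
    rw [mem_finsuppAntidiag']
    exact ⟨(Multiset.toFinsupp_sum_eq (s : Multiset (Fin n))).trans s.2, subset_univ _⟩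
  · intro s _ t _ h
    exact Sym.coe_injective (Multiset.toFinsupp.injective h)
  · intro l hl
    rw [mem_finsuppAntidiag'] at hl
    refine ⟨⟨Finsupp.toMultiset l, ?_⟩, mem_univ _, ?_⟩
    · rw [Finsupp.card_toMultiset]; exact hl.1
    · simp
  · intro s _
    simp only [PowerSeries.coeff_mk, Multiset.toFinsupp_apply]
    rw [Finset.prod_multiset_map_count]
    apply prod_subset (subset_univ _)
    intro x _ hx
    rw [Multiset.mem_toFinset] at hx
    rw [Multiset.count_eq_zero_of_notMem hx, pow_zero]

/-- For every `i ≥ 1` and `n ≥ 1`, the one-row Schur P-function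
`P_i = (1/2) * ∑_{j=0}^{i} e_j * h_{i-j}` lies in the `ℚ`-subalgebra of
`MvPolynomial (Fin n) ℚ` generated by the odd-indexed power sums `p_k`, `k` odd, `1 ≤ k ≤ i`. -/
theorem stmt_3 (i n : ℕ) (hi : 1 ≤ i) (hn : 1 ≤ n) :
    (C (1/2 : ℚ) * ∑ j ∈ Finset.range (i + 1),
        esymm (Fin n) ℚ j * hsymm (Fin n) ℚ (i - j)) ∈
      Algebra.adjoin ℚ
        {q : MvPolynomial (Fin n) ℚ |
          ∃ k, Odd k ∧ 1 ≤ k ∧ k ≤ i ∧ q = psum (Fin n) ℚ k} := by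
  set S := Algebra.adjoin ℚ
        {q : MvPolynomial (Fin n) ℚ |
          ∃ k, Odd k ∧ 1 ≤ k ∧ k ≤ i ∧ q = psum (Fin n) ℚ k} with hS
  have hC : ∀ c : ℚ, (C c : MvPolynomial (Fin n) ℚ) ∈ S := fun c => S.algebraMap_mem c
  apply S.mul_mem (hC _)
  set Q : PowerSeries (MvPolynomial (Fin n) ℚ) := ∏ i : Fin n,
    ((1 + PowerSeries.C (X i : MvPolynomial (Fin n) ℚ) * PowerSeries.X) *
      PowerSeries.mk (fun k => (X i : MvPolynomial (Fin n) ℚ) ^ k)) with hQ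
  have hcoef : ∀ m, PowerSeries.coeff m Q = ∑ j ∈ Finset.range (m + 1),
        esymm (Fin n) ℚ j * hsymm (Fin n) ℚ (m - j) := by
    intro m
    rw [hQ, prod_mul_distrib, PowerSeries.coeff_mul, Nat.sum_antidiagonal_eq_sum_range_succ_mk]
    simp only [aux_E, aux_H]
  rw [← hcoef]
  have hD := aux_prod _ _ (fun i : Fin n => aux_factor (X i : MvPolynomial (Fin n) ℚ)) univ
  rw [← hQ] at hD
  have key : ∀ m, m ≤ i → PowerSeries.coeff m Q ∈ S := by
    intro m
    induction m using Nat.strong_induction_on with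
    | _ m ih =>
      intro hm
      cases m with
      | zero =>
        rw [hcoef]
        simp [S.one_mem]
      | succ m =>
        have h := congrArg (PowerSeries.coeff m) hD
        rw [PowerSeries.coeff_derivative, PowerSeries.coeff_mul] at h
        have h2 : PowerSeries.coeff (m + 1) Q * ((m : MvPolynomial (Fin n) ℚ) + 1) ∈ S := by
          rw [h]
          apply S.sum_mem
          rintro ⟨a, b⟩ hab
          rw [HasAntidiagonal.mem_antidiagonal] at hab
          simp only at hab ⊢
          apply S.mul_mem (ih a (by omega) (by omega))
          rw [map_sum]
          simp only [PowerSeries.coeff_mk]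
          rw [← sum_mul]
          rcases Nat.even_or_odd b with hb | hb
          · apply S.mul_mem
            · exact Algebra.subset_adjoin ⟨b + 1, hb.add_one, by omega, by omega, rfl⟩
            · rw [hb.neg_one_pow]; exact S.add_mem S.one_mem S.one_mem
          · rw [hb.neg_one_pow]; simp [S.zero_mem]
        have h3 := S.mul_mem h2 (hC (1 / ((m : ℚ) + 1)))
        have h4 : ((m : MvPolynomial (Fin n) ℚ) + 1) * C (1 / ((m : ℚ) + 1)) = 1 := by
          have : ((m : MvPolynomial (Fin n) ℚ) + 1) = C ((m : ℚ) + 1) := by simp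
          rw [this, ← C_mul, mul_one_div_cancel (by positivity), C_1]
        rwa [mul_assoc, h4, mul_one] at h3
  exact key i le_rfl
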